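/- arXiv:2007.01709 — 6 statements merged into one kernel-verified Lean document; each statement's English description precedes it below -/
import Mathlib

section
/- The scheme (Nom_z) is a theorem of H_Σ(@_z): for any sorts s,t ∈ S, state symbols z, y of sort t and formula φ of sort t, ⊢_s @_z^s y → (@_z^s φ ↔ @_y^s φ). -/
set_option autoImplicit false

namespace HybridMSHL

/-- A many-sorted signature `(S, Σ)`: a set of sorts and operation symbols
`σ : s1 ⋯ sn → s` given by a domain list of sorts and a codomain sort. -/
structure MSig where
  S : Type
  Op : Type
  dom : Op → List S
  cod : Op → S

abbrev MSig.arity (Sg : MSig) (σ : Sg.Op) : Type := Fin (Sg.dom σ).length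

abbrev MSig.argSort (Sg : MSig) {σ : Sg.Op} (i : Sg.arity σ) : Sg.S := (Sg.dom σ).get i

/-- State symbols of sort `t`: nominals or state variables. -/
abbrev SSym {SS : Type} (N X : SS → Type) (t : SS) : Type := N t ⊕ X t

/-- Formulas of `H_Σ(@_z)` over propositional variables `P`, nominals `N`
and state variables `X`, indexed by their sort. -/
inductive Form (Sg : MSig) (P N X : Sg.S → Type) : Sg.S → Type where
  | prop {s : Sg.S} : P s → Form Sg P N X s
  | nom  {s : Sg.S} : N s → Form Sg P N X s
  | svar {s : Sg.S} : X s → Form Sg P N X s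
  | neg  {s : Sg.S} : Form Sg P N X s → Form Sg P N X s
  | or   {s : Sg.S} : Form Sg P N X s → Form Sg P N X s → Form Sg P N X s
  | op   (σ : Sg.Op) : ((i : Sg.arity σ) → Form Sg P N X (Sg.argSort i)) →
           Form Sg P N X (Sg.cod σ)
  | atf  {t s : Sg.S} : SSym N X t → Form Sg P N X t → Form Sg P N X s

namespace Form

variable {Sg : MSig} {P N X : Sg.S → Type}

def impl {s : Sg.S} (φ ψ : Form Sg P N X s) : Form Sg P N X s := .or (.neg φ) ψ

def conj {s : Sg.S} (φ ψ : Form Sg P N X s) : Form Sg P N X s :=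
  .neg (.or (.neg φ) (.neg ψ))

def equiv {s : Sg.S} (φ ψ : Form Sg P N X s) : Form Sg P N X s :=
  conj (impl φ ψ) (impl ψ φ)

/-- The dual operator `σ□(φ_1,…,φ_n) := ¬σ(¬φ_1,…,¬φ_n)`. -/
def box (σ : Sg.Op) (args : (i : Sg.arity σ) → Form Sg P N X (Sg.argSort i)) :
    Form Sg P N X (Sg.cod σ) := .neg (.op σ fun i => .neg (args i))

/-- A state symbol viewed as a formula of its sort. -/
def ofSSym {t : Sg.S} : SSym N X t → Form Sg P N X t
  | .inl j => .nom j
  | .inr x => .svar x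

/-- `bigConj φ [χ1,…,χn] = φ ∧ χ1 ∧ ⋯ ∧ χn`. -/
def bigConj {s : Sg.S} : Form Sg P N X s → List (Form Sg P N X s) → Form Sg P N X s
  | φ, [] => φ
  | φ, χ :: l => conj φ (bigConj χ l)

/-- `φ` is a propositional tautology: it evaluates to true under every
assignment of truth values to formulas which is compatible with `¬` and `∨`
(all non-Boolean formulas are treated as propositional atoms). -/
def Tautology {s : Sg.S} (φ : Form Sg P N X s) : Prop :=
  ∀ v : ∀ t, Form Sg P N X t → Prop,
    (∀ t (ψ : Form Sg P N X t), v t (.neg ψ) ↔ ¬ v t ψ) →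
    (∀ t (ψ χ : Form Sg P N X t), v t (.or ψ χ) ↔ (v t ψ ∨ v t χ)) →
    v s φ

/-- Occurrence of the nominal `y` (of sort `u`) in a formula. -/
def nomOcc {u : Sg.S} (y : N u) : {s : Sg.S} → Form Sg P N X s → Prop
  | _, .prop _ => False
  | _, .nom j => (⟨_, j⟩ : Σ t, N t) = ⟨u, y⟩
  | _, .svar _ => False
  | _, .neg φ => nomOcc y φ
  | _, .or φ ψ => nomOcc y φ ∨ nomOcc y ψ
  | _, .op _ args => ∃ i, nomOcc y (args i)
  | _, .atf z φ =>
      (match z with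
        | .inl j => (⟨_, j⟩ : Σ t, N t) = ⟨u, y⟩
        | .inr _ => False) ∨ nomOcc y φ

end Form

/-- The deductive system `H_Σ(@_z)` (with an extra set `Λ` of axioms,
`Λ = ∅` gives the plain system). -/
inductive Prf {Sg : MSig} {P N X : Sg.S → Type} (Λ : ∀ s, Set (Form Sg P N X s)) :
    {s : Sg.S} → Form Sg P N X s → Prop where
  | extra {s : Sg.S} {φ : Form Sg P N X s} : φ ∈ Λ s → Prf Λ φ
  | taut {s : Sg.S} {φ : Form Sg P N X s} : φ.Tautology → Prf Λ φ
  | axK (σ : Sg.Op) (args : (i : Sg.arity σ) → Form Sg P N X (Sg.argSort i))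
      (i : Sg.arity σ) (φ χ : Form Sg P N X (Sg.argSort i)) :
      Prf Λ (Form.impl (Form.box σ (Function.update args i (Form.impl φ χ)))
        (Form.impl (Form.box σ (Function.update args i φ))
          (Form.box σ (Function.update args i χ))))
  | axDual (σ : Sg.Op) (args : (i : Sg.arity σ) → Form Sg P N X (Sg.argSort i)) :
      Prf Λ (Form.equiv (Form.op σ args)
        (Form.neg (Form.box σ fun i => Form.neg (args i))))
  | axKat {s t : Sg.S} (z : SSym N X t) (φ ψ : Form Sg P N X t) :
      Prf Λ (Form.impl (Form.atf (s := s) z (Form.impl φ ψ))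
        (Form.impl (Form.atf (s := s) z φ) (Form.atf (s := s) z ψ)))
  | axSelfDual {s t : Sg.S} (z : SSym N X t) (φ : Form Sg P N X t) :
      Prf Λ (Form.equiv (Form.atf (s := s) z φ)
        (Form.neg (Form.atf (s := s) z (Form.neg φ))))
  | axIntro {s : Sg.S} (z : SSym N X s) (φ : Form Sg P N X s) :
      Prf Λ (Form.impl (Form.ofSSym z) (Form.equiv φ (Form.atf (s := s) z φ)))
  | axAgree {t a b : Sg.S} (y : SSym N X a) (z : SSym N X b) (φ : Form Sg P N X b) :
      Prf Λ (Form.equiv (Form.atf (s := t) y (Form.atf (s := a) z φ))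
        (Form.atf (s := t) z φ))
  | axRef {s t : Sg.S} (z : SSym N X t) : Prf Λ (Form.atf (s := s) z (Form.ofSSym z))
  | axBack (σ : Sg.Op) (args : (i : Sg.arity σ) → Form Sg P N X (Sg.argSort i))
      (i : Sg.arity σ) {t : Sg.S} (z : SSym N X t) (ψ : Form Sg P N X t) :
      Prf Λ (Form.impl
        (Form.op σ (Function.update args i (Form.atf (s := Sg.argSort i) z ψ)))
        (Form.atf (s := Sg.cod σ) z ψ))
  | mp {s : Sg.S} {φ ψ : Form Sg P N X s} : Prf Λ (Form.impl φ ψ) → Prf Λ φ → Prf Λ ψ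
  | ug (σ : Sg.Op) (args : (i : Sg.arity σ) → Form Sg P N X (Sg.argSort i))
      (i : Sg.arity σ) {φ : Form Sg P N X (Sg.argSort i)} :
      Prf Λ φ → Prf Λ (Form.box σ (Function.update args i φ))
  | broadcast {s s' t : Sg.S} (z : SSym N X t) (φ : Form Sg P N X t) :
      Prf Λ (Form.atf (s := s) z φ) → Prf Λ (Form.atf (s := s') z φ)
  | genAt {s t : Sg.S} (z : SSym N X t) (φ : Form Sg P N X t) :
      Prf Λ φ → Prf Λ (Form.atf (s := s) z φ)
  | paste0 {s t : Sg.S} (z : SSym N X t) (y : N t) (φ : Form Sg P N X t)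
      (ψ : Form Sg P N X s) :
      Sum.inl y ≠ z → ¬ Form.nomOcc y φ → ¬ Form.nomOcc y ψ →
      Prf Λ (Form.impl (Form.atf (s := s) z (Form.conj (Form.nom y) φ)) ψ) →
      Prf Λ (Form.impl (Form.atf (s := s) z φ) ψ)
  | paste1 {s : Sg.S} (σ : Sg.Op) (args : (i : Sg.arity σ) → Form Sg P N X (Sg.argSort i))
      (i : Sg.arity σ) (z : SSym N X (Sg.cod σ)) (y : N (Sg.argSort i))
      (φ : Form Sg P N X (Sg.argSort i)) (ψ : Form Sg P N X s) :
      (⟨_, Sum.inl y⟩ : Σ t, SSym N X t) ≠ ⟨_, z⟩ →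
      ¬ Form.nomOcc y φ → ¬ Form.nomOcc y ψ →
      Prf Λ (Form.impl
        (Form.atf (s := s) z (Form.op σ (Function.update args i (Form.conj (Form.nom y) φ)))) ψ) →
      Prf Λ (Form.impl (Form.atf (s := s) z (Form.op σ (Function.update args i φ))) ψ)

/-- The plain system `H_Σ(@_z)`: no extra axioms. -/
def NoAx {Sg : MSig} {P N X : Sg.S → Type} : ∀ s, Set (Form Sg P N X s) := fun _ => ∅

/-- `⊢_s φ` in `H_Σ(@_z)`. -/
def Thm {Sg : MSig} {P N X : Sg.S → Type} {s : Sg.S} (φ : Form Sg P N X s) : Prop :=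
  Prf NoAx φ

/-- An `(S,Σ)`-model: nonempty sorted worlds, relations interpreting the
operation symbols, a valuation of propositional variables and a valuation of
nominals (each nominal denotes a singleton, i.e. a single world). -/
structure Model (Sg : MSig) (P N : Sg.S → Type) where
  W : Sg.S → Type
  Wne : ∀ s, Nonempty (W s)
  R : (σ : Sg.Op) → W (Sg.cod σ) → ((i : Sg.arity σ) → W (Sg.argSort i)) → Prop
  Vp : ∀ s, P s → Set (W s)
  Vn : ∀ s, N s → W s

variable {Sg : MSig} {P N X : Sg.S → Type}

/-- Denotation of a state symbol under an assignment. -/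
def Model.den (M : Model Sg P N) (g : ∀ t, X t → M.W t) {t : Sg.S} :
    SSym N X t → M.W t
  | .inl j => M.Vn t j
  | .inr x => g t x

/-- The satisfaction relation `M,g,w ⊨_s φ`. -/
def Sat' (M : Model Sg P N) (g : ∀ t, X t → M.W t) :
    {s : Sg.S} → Form Sg P N X s → M.W s → Prop
  | _, .prop p, w => w ∈ M.Vp _ p
  | _, .nom j, w => w = M.Vn _ j
  | _, .svar x, w => w = g _ x
  | _, .neg φ, w => ¬ Sat' M g φ w
  | _, .or φ ψ, w => Sat' M g φ w ∨ Sat' M g ψ w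
  | _, .op σ args, w => ∃ u : (i : Sg.arity σ) → M.W (Sg.argSort i),
      M.R σ w u ∧ ∀ i, Sat' M g (args i) (u i)
  | _, .atf z φ, _ => Sat' M g φ (M.den g z)

/-- The satisfaction relation `M,g,w ⊨_s φ`. -/
abbrev Sat (M : Model Sg P N) (g : ∀ t, X t → M.W t) {s : Sg.S}
    (w : M.W s) (φ : Form Sg P N X s) : Prop := Sat' M g φ w

/-- A model is named if every world is the denotation of some nominal. -/
def Model.Named (M : Model Sg P N) : Prop :=
  ∀ s (w : M.W s), ∃ j : N s, M.Vn s j = w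

/-- `Γ` is consistent: no finite list of its members has a provably false
conjunction. -/
def Consistent (Λ : ∀ s, Set (Form Sg P N X s)) {s : Sg.S}
    (Γ : Set (Form Sg P N X s)) : Prop :=
  ¬ ∃ (φ : Form Sg P N X s) (l : List (Form Sg P N X s)),
      φ ∈ Γ ∧ (∀ χ ∈ l, χ ∈ Γ) ∧ Prf Λ (Form.neg (Form.bigConj φ l))

/-- `Γ` is maximal consistent. -/
def MaxConsistent (Λ : ∀ s, Set (Form Sg P N X s)) {s : Sg.S}
    (Γ : Set (Form Sg P N X s)) : Prop :=
  Consistent Λ Γ ∧ ∀ φ : Form Sg P N X s, φ ∈ Γ ∨ Form.neg φ ∈ Γ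

/-- `Δ_z = {φ : @_z φ ∈ Γ}`. -/
def Dset {s : Sg.S} (Γ : Set (Form Sg P N X s)) {t : Sg.S} (z : SSym N X t) :
    Set (Form Sg P N X t) :=
  {φ | (Form.atf (s := s) z φ) ∈ Γ}

/-- `Γ` is named if it contains a nominal. -/
def NamedSet {s : Sg.S} (Γ : Set (Form Sg P N X s)) : Prop :=
  ∃ j : N s, Form.nom j ∈ Γ

def Pasted0 {s : Sg.S} (Γ : Set (Form Sg P N X s)) : Prop :=
  ∀ (t : Sg.S) (z : SSym N X t) (φ : Form Sg P N X t),
    (Form.atf (s := s) z φ) ∈ Γ →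
    ∃ j : N t, (Form.atf (s := s) z (Form.conj (Form.nom j) φ)) ∈ Γ

def Pasted1 {s : Sg.S} (Γ : Set (Form Sg P N X s)) : Prop :=
  ∀ (σ : Sg.Op) (z : SSym N X (Sg.cod σ))
    (args : (i : Sg.arity σ) → Form Sg P N X (Sg.argSort i)) (i : Sg.arity σ),
    (Form.atf (s := s) z (Form.op σ args)) ∈ Γ →
    ∃ j : N (Sg.argSort i),
      (Form.atf (s := s) z
        (Form.op σ (Function.update args i (Form.conj (Form.nom j) (args i))))) ∈ Γ

def PastedSet {s : Sg.S} (Γ : Set (Form Sg P N X s)) : Prop :=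
  Pasted0 Γ ∧ Pasted1 Γ

/-- Worlds of the named (canonical) model generated by an `S`-sorted family `Γfam`:
the sets `Δ_z` for state symbols `z` of the given sort. -/
def CWorld (Γfam : ∀ t, Set (Form Sg P N X t)) (t : Sg.S) : Type :=
  {Δ : Set (Form Sg P N X t) // ∃ z : SSym N X t, Δ = Dset (Γfam t) z}

/-- The canonical relations. -/
def CRel (Γfam : ∀ t, Set (Form Sg P N X t)) (σ : Sg.Op)
    (w : CWorld Γfam (Sg.cod σ)) (u : (i : Sg.arity σ) → CWorld Γfam (Sg.argSort i)) : Prop :=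
  ∀ args : (i : Sg.arity σ) → Form Sg P N X (Sg.argSort i),
    (∀ i, args i ∈ (u i).1) → Form.op σ args ∈ w.1

/-- The named (canonical) model generated by `Γfam`. -/
noncomputable def canModel (Γfam : ∀ t, Set (Form Sg P N X t))
    [inst : ∀ t, Nonempty (N t)] : Model Sg P N where
  W := CWorld Γfam
  Wne := fun t => ⟨⟨Dset (Γfam t) (Sum.inl (Classical.arbitrary (N t))), ⟨_, rfl⟩⟩⟩
  R := CRel Γfam
  Vp := fun s p => {w : CWorld Γfam s | Form.prop p ∈ w.1}
  Vn := fun t j => ⟨Dset (Γfam t) (Sum.inl j), ⟨_, rfl⟩⟩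

/-- The natural assignment: a state variable `x` is sent to the world `Δ_x`. -/
def natAssign (Γfam : ∀ t, Set (Form Sg P N X t)) :
    ∀ t, X t → CWorld Γfam t := fun t x => ⟨Dset (Γfam t) (Sum.inr x), ⟨_, rfl⟩⟩

/-- Translation of formulas into the language with countably many new
nominals added to every sort. -/
def Form.extNom : {s : Sg.S} → Form Sg P N X s → Form Sg P (fun t => N t ⊕ ℕ) X s
  | _, .prop p => .prop p
  | _, .nom j => .nom (Sum.inl j)
  | _, .svar x => .svar x
  | _, .neg φ => .neg φ.extNom
  | _, .or φ ψ => .or φ.extNom ψ.extNom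
  | _, .op σ args => .op σ fun i => (args i).extNom
  | _, .atf z φ => .atf (Sum.map Sum.inl id z) φ.extNom


theorem Form.Tautology.of_eval {s : Sg.S} {φ : Form Sg P N X s}
    (h : ∀ v : ∀ t, Form Sg P N X t → Prop,
      (∀ t (ψ : Form Sg P N X t), v t (.neg ψ) ↔ ¬ v t ψ) →
      (∀ t (ψ χ : Form Sg P N X t), v t (.or ψ χ) ↔ (v t ψ ∨ v t χ)) →
      (∀ t (ψ χ : Form Sg P N X t), v t (.impl ψ χ) ↔ (v t ψ → v t χ)) →
      (∀ t (ψ χ : Form Sg P N X t), v t (.equiv ψ χ) ↔ (v t ψ ↔ v t χ)) →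
      v s φ) : φ.Tautology := by
  intro v hneg hor
  refine h v hneg hor ?_ ?_ <;> intro t ψ χ <;>
    simp only [Form.equiv, Form.conj, Form.impl, hneg, hor] <;> tauto

namespace Prf

variable {Λ : ∀ s, Set (Form Sg P N X s)}

/-- Monotonicity of `@_z` with respect to provable implication. -/
theorem at_mono {s t : Sg.S} (z : SSym N X t) {φ ψ : Form Sg P N X t}
    (h : Prf Λ (Form.impl φ ψ)) :
    Prf Λ (Form.impl (Form.atf (s := s) z φ) (Form.atf (s := s) z ψ)) :=
  mp (axKat z φ ψ) (genAt z _ h)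

/-- `@_z` preserves equivalence: `@_z (φ ↔ ψ) → (@_z φ ↔ @_z ψ)`. -/
theorem at_equiv {s t : Sg.S} (z : SSym N X t) (φ ψ : Form Sg P N X t) :
    Prf Λ (Form.impl (Form.atf (s := s) z (Form.equiv φ ψ))
      (Form.equiv (Form.atf (s := s) z φ) (Form.atf (s := s) z ψ))) := by
  have hl : Prf Λ (Form.impl (Form.equiv φ ψ) (Form.impl φ ψ)) :=
    taut (.of_eval fun v _ _ himpl hequiv => by simp only [himpl, hequiv]; tauto)
  have hr : Prf Λ (Form.impl (Form.equiv φ ψ) (Form.impl ψ φ)) :=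
    taut (.of_eval fun v _ _ himpl hequiv => by simp only [himpl, hequiv]; tauto)
  refine mp (mp (mp (mp (taut (.of_eval fun v _ _ himpl hequiv => ?_))
    (at_mono (s := s) z hl)) (axKat z φ ψ)) (at_mono (s := s) z hr)) (axKat z ψ φ)
  simp only [himpl, hequiv]
  tauto

end Prf

/-- The scheme (Nom_z) is a theorem of `H_Σ(@_z)`. -/
theorem nomz_thm {s t : Sg.S} (z y : SSym N X t) (φ : Form Sg P N X t) :
    Thm (Form.impl (Form.atf (s := s) z (Form.ofSSym y))
      (Form.equiv (Form.atf (s := s) z φ) (Form.atf (s := s) y φ))) := by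
  have hintro : Prf NoAx (Form.impl (Form.atf (s := s) z (Form.ofSSym y))
      (Form.atf (s := s) z (Form.equiv φ (Form.atf (s := t) y φ)))) :=
    Prf.at_mono z (Prf.axIntro y φ)
  refine Prf.mp (Prf.mp (Prf.mp (Prf.taut (.of_eval fun v _ _ himpl hequiv => ?_)) hintro)
    (Prf.at_equiv z φ (Form.atf (s := t) y φ))) (Prf.axAgree (a := t) z y φ)
  simp only [himpl, hequiv]
  tauto

end HybridMSHL
end

section
/- The scheme (Sym) is a theorem of H_Σ(@_z): for any sorts s,t ∈ S and state symbols z, y of sort t, ⊢_s @_z^s y → @_y^s z. -/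
set_option autoImplicit false

namespace HybridMSHL

variable {Sg : MSig} {P N X : Sg.S → Type}

namespace Prf

variable {Λ : ∀ s, Set (Form Sg P N X s)} {s t : Sg.S}

theorem impl_trans {φ ψ χ : Form Sg P N X s} (h₁ : Prf Λ (Form.impl φ ψ))
    (h₂ : Prf Λ (Form.impl ψ χ)) : Prf Λ (Form.impl φ χ) := by
  refine .mp (.mp (.taut ?_) h₁) h₂
  intro v hn ho
  simp only [Form.impl, hn, ho]
  tauto

theorem impl_mp {φ ψ χ : Form Sg P N X s} (h₁ : Prf Λ (Form.impl φ (Form.impl ψ χ)))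
    (h₂ : Prf Λ ψ) : Prf Λ (Form.impl φ χ) := by
  refine .mp (.mp (.taut ?_) h₁) h₂
  intro v hn ho
  simp only [Form.impl, hn, ho]
  tauto

theorem equiv_mp {φ ψ : Form Sg P N X s} (h : Prf Λ (Form.equiv φ ψ)) :
    Prf Λ (Form.impl φ ψ) := by
  refine .mp (.taut ?_) h
  intro v hn ho
  simp only [Form.equiv, Form.conj, Form.impl, hn, ho]
  tauto

theorem impl_equiv_mp {φ ψ χ : Form Sg P N X s}
    (h : Prf Λ (Form.impl φ (Form.equiv ψ χ))) :
    Prf Λ (Form.impl φ (Form.impl ψ χ)) := by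
  refine .mp (.taut ?_) h
  intro v hn ho
  simp only [Form.equiv, Form.conj, Form.impl, hn, ho]
  tauto

theorem atf_mono (z : SSym N X t) {φ ψ : Form Sg P N X t} (h : Prf Λ (Form.impl φ ψ)) :
    Prf Λ (Form.impl (Form.atf (s := s) z φ) (Form.atf (s := s) z ψ)) :=
  .mp (.axKat z φ ψ) (.genAt z _ h)

end Prf

/-- The scheme (Sym) is a theorem of `H_Σ(@_z)`. -/
theorem sym_thm {s t : Sg.S} (z y : SSym N X t) :
    Thm (Form.impl (Form.atf (s := s) z (Form.ofSSym (P := P) y))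
      (Form.atf (s := s) y (Form.ofSSym (P := P) z))) := by
  have intro_y := Prf.impl_equiv_mp (Prf.axIntro (Λ := NoAx) y (Form.ofSSym (P := P) z))
  have nested := Prf.impl_mp
    (Prf.impl_trans (Prf.atf_mono (s := s) z intro_y) (.axKat z _ _)) (.axRef z)
  exact Prf.impl_trans nested (Prf.equiv_mp (.axAgree z y _))

end HybridMSHL
end

section
/- The scheme (Bridge) is a theorem of H_Σ(@_z): for any σ ∈ Σ_{s1⋯sn,s}, any index i, any state symbol z of sort s_i, any formula φ of sort s_i, and any formulas φ_1,…,φ_{i-1},φ_{i+1},…,φ_n of the appropriate sorts, ⊢_s σ(φ_1,…,φ_{i-1}, z, φ_{i+1},…,φ_n) ∧ @_z^s φ → σ(φ_1,…,φ_{i-1}, φ, φ_{i+1},…,φ_n). -/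
set_option autoImplicit false

namespace HybridMSHL

variable {Sg : MSig} {P N X : Sg.S → Type}

theorem Form.neg_update (σ : Sg.Op) (args : (i : Sg.arity σ) → Form Sg P N X (Sg.argSort i))
    (i : Sg.arity σ) (φ : Form Sg P N X (Sg.argSort i)) :
    (fun j => Form.neg (Function.update args i φ j)) =
      Function.update (fun j => Form.neg (args j)) i (Form.neg φ) :=
  funext fun j => Function.apply_update (fun _ => Form.neg) args i φ j

/-- (Dual) in a single argument: `σ(…,φ,…) ↔ ¬σ□(…,¬φ,…)`, the other arguments being negated
under `σ□`. -/
theorem Prf.dual_update {Λ : ∀ s, Set (Form Sg P N X s)} (σ : Sg.Op)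
    (args : (i : Sg.arity σ) → Form Sg P N X (Sg.argSort i))
    (i : Sg.arity σ) (φ : Form Sg P N X (Sg.argSort i)) :
    Prf Λ (Form.equiv (Form.op σ (Function.update args i φ))
      (Form.neg (Form.box σ
        (Function.update (fun j => Form.neg (args j)) i (Form.neg φ))))) := by
  rw [← Form.neg_update]
  exact .axDual σ _

/-- Each operation symbol distributes over disjunctions in each of its arguments. -/
theorem Prf.op_update_or {Λ : ∀ s, Set (Form Sg P N X s)} (σ : Sg.Op)
    (args : (i : Sg.arity σ) → Form Sg P N X (Sg.argSort i))
    (i : Sg.arity σ) {α β γ : Form Sg P N X (Sg.argSort i)}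
    (h : Prf Λ (Form.impl α (Form.or β γ))) :
    Prf Λ (Form.impl (Form.op σ (Function.update args i α))
      (Form.or (Form.op σ (Function.update args i β))
        (Form.op σ (Function.update args i γ)))) := by
  have hcontra : Prf Λ (Form.impl (Form.neg β) (Form.impl (Form.neg γ) (Form.neg α))) := by
    refine .mp (.taut ?_) h
    intro v hn ho
    simp only [Form.impl, hn, ho]
    tauto
  have hbox := Prf.mp (.axK σ (fun j => Form.neg (args j)) i _ _)
    (.ug σ (fun j => Form.neg (args j)) i hcontra)
  have hK := Prf.axK (Λ := Λ) σ (fun j => Form.neg (args j)) i (Form.neg γ) (Form.neg α)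
  refine .mp (.mp (.mp (.mp (.mp (.taut ?_) hbox) hK)
    (.dual_update σ args i α)) (.dual_update σ args i β)) (.dual_update σ args i γ)
  intro v hn ho
  simp only [Form.impl, Form.equiv, Form.conj, hn, ho]
  tauto

/-- The scheme (Bridge) is a theorem of `H_Σ(@_z)`. -/
theorem bridge_thm (σ : Sg.Op) (args : (i : Sg.arity σ) → Form Sg P N X (Sg.argSort i))
    (i : Sg.arity σ) (z : SSym N X (Sg.argSort i)) (φ : Form Sg P N X (Sg.argSort i)) :
    Thm (Form.impl
      (Form.conj (Form.op σ (Function.update args i (Form.ofSSym z)))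
        (Form.atf (s := Sg.cod σ) z φ))
      (Form.op σ (Function.update args i φ))) := by
  have hcases : Prf NoAx (Form.impl (Form.ofSSym z)
      (Form.or φ (Form.atf (s := Sg.argSort i) z (Form.neg φ)))) := by
    refine .mp (.taut ?_) (.axIntro z (Form.neg φ))
    intro v hn ho
    simp only [Form.impl, Form.equiv, Form.conj, hn, ho]
    tauto
  refine .mp (.mp (.mp (.taut ?_) (.op_update_or σ args i hcases))
    (.axBack σ args i z (Form.neg φ))) (.axSelfDual z φ)
  intro v hn ho
  simp only [Form.impl, Form.equiv, Form.conj, hn, ho]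
  tauto

end HybridMSHL
end

section
/- Let Γ_s be a maximal consistent set of formulas of sort s in H_Σ(@_z) that contains a state symbol of sort s, and for each state symbol z of sort t let Δ_z = {φ of sort t : @_z^s φ ∈ Γ_s}. Then for every state symbol z, the set Δ_z is a maximal consistent set (of formulas of the sort of z) and z ∈ Δ_z. -/
set_option autoImplicit false

namespace HybridMSHL

variable {Sg : MSig} {P N X : Sg.S → Type}

namespace Form

theorem tautology_impl_conj {s : Sg.S} (φ ψ : Form Sg P N X s) :
    (impl φ (impl ψ (conj φ ψ))).Tautology := by
  intro v hneg hor
  simp only [impl, conj, hneg, hor]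
  tauto

end Form

namespace MaxConsistent

variable {Λ : ∀ s, Set (Form Sg P N X s)} {s : Sg.S} {Γ : Set (Form Sg P N X s)}

theorem mem_of_prf (hΓ : MaxConsistent Λ Γ) {φ : Form Sg P N X s} (h : Prf Λ φ) : φ ∈ Γ := by
  refine (hΓ.2 φ).resolve_right fun hn => hΓ.1 ⟨φ.neg, [], hn, by simp, ?_⟩
  refine Prf.mp (Prf.taut ?_) h
  intro v hneg hor
  simp only [Form.impl, Form.bigConj, hneg, hor]
  tauto

theorem mp_mem (hΓ : MaxConsistent Λ Γ) {φ ψ : Form Sg P N X s}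
    (hi : Form.impl φ ψ ∈ Γ) (h : φ ∈ Γ) : ψ ∈ Γ := by
  refine (hΓ.2 ψ).resolve_right fun hn =>
    hΓ.1 ⟨Form.impl φ ψ, [φ, ψ.neg], hi, by simp [h, hn], Prf.taut ?_⟩
  intro v hneg hor
  simp only [Form.impl, Form.conj, Form.bigConj, hneg, hor]
  tauto

theorem neg_notMem (hΓ : MaxConsistent Λ Γ) {φ : Form Sg P N X s} (h : φ ∈ Γ) :
    φ.neg ∉ Γ := by
  refine fun hn => hΓ.1 ⟨φ, [φ.neg], h, by simp [hn], Prf.taut ?_⟩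
  intro v hneg hor
  simp only [Form.conj, Form.bigConj, hneg, hor]
  tauto

variable {t : Sg.S}

theorem mem_dset_of_prf (hΓ : MaxConsistent Λ Γ) (z : SSym N X t) {φ : Form Sg P N X t}
    (h : Prf Λ φ) : φ ∈ Dset Γ z :=
  hΓ.mem_of_prf (Prf.genAt z φ h)

theorem mp_mem_dset (hΓ : MaxConsistent Λ Γ) {z : SSym N X t} {φ ψ : Form Sg P N X t}
    (hi : Form.impl φ ψ ∈ Dset Γ z) (h : φ ∈ Dset Γ z) : ψ ∈ Dset Γ z :=
  hΓ.mp_mem (hΓ.mp_mem (hΓ.mem_of_prf (Prf.axKat z φ ψ)) hi) h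

theorem bigConj_mem_dset (hΓ : MaxConsistent Λ Γ) {z : SSym N X t} {φ : Form Sg P N X t}
    {l : List (Form Sg P N X t)} (hφ : φ ∈ Dset Γ z) (hl : ∀ χ ∈ l, χ ∈ Dset Γ z) :
    Form.bigConj φ l ∈ Dset Γ z := by
  induction l generalizing φ with
  | nil => exact hφ
  | cons χ l ih =>
    rw [List.forall_mem_cons] at hl
    exact hΓ.mp_mem_dset (hΓ.mp_mem_dset
      (hΓ.mem_dset_of_prf z (Prf.taut (Form.tautology_impl_conj _ _))) hφ) (ih hl.1 hl.2)

theorem neg_mem_dset_iff (hΓ : MaxConsistent Λ Γ) {z : SSym N X t} {φ : Form Sg P N X t} :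
    φ.neg ∈ Dset Γ z ↔ φ ∉ Dset Γ z := by
  have hsd := Prf.axSelfDual (Λ := Λ) (s := s) z φ
  constructor
  · intro hn h
    refine hΓ.neg_notMem hn (hΓ.mp_mem (hΓ.mem_of_prf (Prf.mp (Prf.taut ?_) hsd)) h)
    intro v hneg hor
    simp only [Form.impl, Form.conj, Form.equiv, hneg, hor]
    tauto
  · intro h
    refine hΓ.mp_mem (hΓ.mem_of_prf (Prf.mp (Prf.taut ?_) hsd)) ((hΓ.2 _).resolve_left h)
    intro v hneg hor
    simp only [Form.impl, Form.conj, Form.equiv, hneg, hor]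
    tauto

protected theorem dset (hΓ : MaxConsistent Λ Γ) (z : SSym N X t) :
    MaxConsistent Λ (Dset Γ z) := by
  refine ⟨?_, fun φ => ?_⟩
  · rintro ⟨φ, l, hφ, hl, h⟩
    exact hΓ.neg_mem_dset_iff.1 (hΓ.mem_dset_of_prf z h) (hΓ.bigConj_mem_dset hφ hl)
  · rw [hΓ.neg_mem_dset_iff]
    exact em _

end MaxConsistent

/-- The sets `Δ_z` are maximal consistent and contain `z`. -/
theorem dset_maxConsistent {s : Sg.S} (Γ : Set (Form Sg P N X s))
    (hΓ : MaxConsistent NoAx Γ) (hstate : ∃ z0 : SSym N X s, Form.ofSSym z0 ∈ Γ)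
    {t : Sg.S} (z : SSym N X t) :
    MaxConsistent NoAx (Dset Γ z) ∧ Form.ofSSym z ∈ Dset Γ z := by
  exact ⟨hΓ.dset z, hΓ.mem_of_prf (Prf.axRef z)⟩

end HybridMSHL
end

section
/- (@-agreement) Let Γ_s be a maximal consistent set of formulas of sort s in H_Σ(@_z) that contains a state symbol of sort s, and for each state symbol y of sort t let Δ_y = {φ of sort t : @_y^s φ ∈ Γ_s}. Then for all state symbols y of sort t and z of sort t', and every formula φ of sort t', we have @_z^t φ ∈ Δ_y if and only if @_z^s φ ∈ Γ_s. -/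
set_option autoImplicit false

namespace HybridMSHL

variable {Sg : MSig} {P N X : Sg.S → Type}

theorem Prf.impl_of_equiv {Λ : ∀ s, Set (Form Sg P N X s)} {s : Sg.S}
    {φ ψ : Form Sg P N X s} (h : Prf Λ (Form.equiv φ ψ)) : Prf Λ (Form.impl φ ψ) := by
  refine .mp (.taut fun v hneg hor => ?_) h
  simp only [Form.equiv, Form.conj, Form.impl, hneg, hor]
  tauto

theorem Prf.impl_symm_of_equiv {Λ : ∀ s, Set (Form Sg P N X s)} {s : Sg.S}
    {φ ψ : Form Sg P N X s} (h : Prf Λ (Form.equiv φ ψ)) : Prf Λ (Form.impl ψ φ) := by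
  refine .mp (.taut fun v hneg hor => ?_) h
  simp only [Form.equiv, Form.conj, Form.impl, hneg, hor]
  tauto

/-- Maximal consistent sets are closed under provable implication. -/
theorem MaxConsistent.mem_of_impl {Λ : ∀ s, Set (Form Sg P N X s)} {s : Sg.S}
    {Γ : Set (Form Sg P N X s)} (hΓ : MaxConsistent Λ Γ) {φ ψ : Form Sg P N X s}
    (h : Prf Λ (Form.impl φ ψ)) (hφ : φ ∈ Γ) : ψ ∈ Γ := by
  refine (hΓ.2 ψ).resolve_right fun hψ => hΓ.1 ⟨φ, [.neg ψ], hφ, by simpa using hψ, ?_⟩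
  refine .mp (.taut fun v hneg hor => ?_) h
  simp only [Form.bigConj, Form.conj, Form.impl, hneg, hor]
  tauto

/-- Maximal consistent sets are closed under provable equivalence. -/
theorem MaxConsistent.mem_iff_of_equiv {Λ : ∀ s, Set (Form Sg P N X s)} {s : Sg.S}
    {Γ : Set (Form Sg P N X s)} (hΓ : MaxConsistent Λ Γ) {φ ψ : Form Sg P N X s}
    (h : Prf Λ (Form.equiv φ ψ)) : φ ∈ Γ ↔ ψ ∈ Γ :=
  ⟨hΓ.mem_of_impl h.impl_of_equiv, hΓ.mem_of_impl h.impl_symm_of_equiv⟩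

/-- @-agreement for the sets `Δ_y`. -/
theorem dset_agree {s : Sg.S} (Γ : Set (Form Sg P N X s))
    (hΓ : MaxConsistent NoAx Γ) (hstate : ∃ z0 : SSym N X s, Form.ofSSym z0 ∈ Γ)
    {t t' : Sg.S} (y : SSym N X t) (z : SSym N X t') (φ : Form Sg P N X t') :
    (Form.atf (s := t) z φ) ∈ Dset Γ y ↔ (Form.atf (s := s) z φ) ∈ Γ :=
  hΓ.mem_iff_of_equiv (.axAgree y z φ)

end HybridMSHL
end

section
/- Let Γ_s be a maximal consistent set of formulas of sort s in H_Σ(@_z) that contains a state symbol of sort s, and for each state symbol z of sort t let Δ_z = {φ of sort t : @_z^s φ ∈ Γ_s}. Then there is a state symbol z of sort s such that Γ_s = Δ_z. -/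
set_option autoImplicit false

namespace HybridMSHL

variable {Sg : MSig} {P N X : Sg.S → Type}

theorem MaxConsistent.mem_of_prf_impl {Λ : ∀ s, Set (Form Sg P N X s)} {s : Sg.S}
    {Γ : Set (Form Sg P N X s)} (hΓ : MaxConsistent Λ Γ) {φ ψ χ : Form Sg P N X s}
    (h : Prf Λ (.impl φ (.impl ψ χ))) (hφ : φ ∈ Γ) (hψ : ψ ∈ Γ) : χ ∈ Γ := by
  refine (hΓ.2 χ).resolve_right fun hχ => hΓ.1 ⟨φ, [ψ, .neg χ], hφ, by simp [hψ, hχ], ?_⟩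
  refine .mp (.taut fun v hneg hor => ?_) h
  simp only [Form.bigConj, Form.conj, Form.impl, hneg, hor]
  tauto

theorem Prf.atf_intro {Λ : ∀ s, Set (Form Sg P N X s)} {s : Sg.S} (z : SSym N X s)
    (φ : Form Sg P N X s) : Prf Λ (.impl (.ofSSym z) (.impl φ (.atf (s := s) z φ))) := by
  refine .mp (.taut fun v hneg hor => ?_) (.axIntro z φ)
  simp only [Form.equiv, Form.conj, Form.impl, hneg, hor]
  tauto

theorem Prf.atf_elim {Λ : ∀ s, Set (Form Sg P N X s)} {s : Sg.S} (z : SSym N X s)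
    (φ : Form Sg P N X s) : Prf Λ (.impl (.ofSSym z) (.impl (.atf (s := s) z φ) φ)) := by
  refine .mp (.taut fun v hneg hor => ?_) (.axIntro z φ)
  simp only [Form.equiv, Form.conj, Form.impl, hneg, hor]
  tauto

/-- `Γ_s` is one of the sets `Δ_z`. -/
theorem dset_self {s : Sg.S} (Γ : Set (Form Sg P N X s))
    (hΓ : MaxConsistent NoAx Γ) (hstate : ∃ z0 : SSym N X s, Form.ofSSym z0 ∈ Γ) :
    ∃ z : SSym N X s, Γ = Dset Γ z := by
  obtain ⟨z, hz⟩ := hstate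
  exact ⟨z, Set.ext fun φ => ⟨hΓ.mem_of_prf_impl (.atf_intro z φ) hz,
    hΓ.mem_of_prf_impl (.atf_elim z φ) hz⟩⟩

end HybridMSHL
end
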